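/- Let n ≥ 2 and let R be an algebraic Kähler curvature tensor on ℂ^n. Then CQB₁ ≤ 0 holds if and only if for all x, y : Fin n → ℂ one has ‖x‖² · Ric(y,ȳ) − R(x,x̄,y,ȳ) ≤ 0; if CQB₁ < 0 the inequality is strict for nonzero x, y. Moreover, if CQB₁ ≤ 0 then for every x: (n−1) · ‖x‖² · Ric(x,x̄) ≤ ‖x‖² · Ric(x,x̄) − R(x,x̄,x,x̄) ≤ 0; in particular Ric(x,x̄) ≤ 0 for every x. (The CQB part of Theorem 5.1, pointwise/algebraic form.) -/

import Mathlib

open Finset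

/-- An algebraic Kähler curvature tensor on ℂ^n: Kähler symmetries and reality. -/
noncomputable def IsKahlerCurv {n : ℕ} (R : Fin n → Fin n → Fin n → Fin n → ℂ) : Prop :=
  (∀ a b c d, R a b c d = R c b a d) ∧
  (∀ a b c d, R a b c d = R a d c b) ∧
  (∀ a b c d, star (R a b c d) = R b a d c)

/-- The Ricci tensor `Ric a b = ∑ c, R a b c c`. -/
noncomputable def ricT {n : ℕ} (R : Fin n → Fin n → Fin n → Fin n → ℂ) (a b : Fin n) : ℂ :=
  ∑ c, R a b c c

/-- `Ric(x, ȳ)`. -/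
noncomputable def ricForm {n : ℕ} (R : Fin n → Fin n → Fin n → Fin n → ℂ) (x y : Fin n → ℂ) : ℂ :=
  ∑ a, ∑ b, ricT R a b * x a * star (y b)

/-- The bisectional curvature `R(x, x̄, y, ȳ)`. -/
noncomputable def bisec {n : ℕ} (R : Fin n → Fin n → Fin n → Fin n → ℂ) (x y : Fin n → ℂ) : ℂ :=
  ∑ a, ∑ b, ∑ c, ∑ d, R a b c d * x a * star (x b) * y c * star (y d)

/-- `‖x‖²`. -/
noncomputable def norm2 {n : ℕ} (x : Fin n → ℂ) : ℝ := ∑ a, ‖x a‖ ^ 2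

/-- The cross quadratic bisectional curvature quadratic form on matrices. -/
noncomputable def CQB {n : ℕ} (R : Fin n → Fin n → Fin n → Fin n → ℂ)
    (A : Matrix (Fin n) (Fin n) ℂ) : ℝ :=
  ((∑ a, ∑ b, ∑ c, ricT R a b * A c a * star (A c b)) -
    (∑ a, ∑ b, ∑ c, ∑ d, R a b c d * A a c * star (A b d))).re

theorem Matrix.exists_eq_vecMulVec_of_rank_le_one {K m n : Type*} [Field K] [Finite m] [Fintype n]
    {A : Matrix m n K} (hA : A.rank ≤ 1) : ∃ w v, A = Matrix.vecMulVec w v := by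
  classical
  rw [Matrix.rank, finrank_le_one_iff] at hA
  obtain ⟨w, hw⟩ := hA
  choose v hv using fun j ↦ hw ⟨A.mulVecLin (Pi.single j 1), LinearMap.mem_range_self _ _⟩
  refine ⟨w, v, ?_⟩
  ext i j
  have h := congrFun (congrArg Subtype.val (hv j)) i
  simpa [Matrix.vecMulVec_apply, mul_comm] using h.symm

theorem ofReal_norm2 {n : ℕ} (x : Fin n → ℂ) : (norm2 x : ℂ) = ∑ a, x a * star (x a) := by
  simp [norm2, Complex.mul_conj']

theorem norm2_pos {n : ℕ} {x : Fin n → ℂ} (hx : x ≠ 0) : 0 < norm2 x := by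
  obtain ⟨i, hi⟩ := Function.ne_iff.mp hx
  exact Finset.sum_pos' (fun _ _ ↦ by positivity)
    ⟨i, Finset.mem_univ i, pow_pos (norm_pos_iff.mpr hi) 2⟩

theorem CQB_vecMulVec {n : ℕ} (R : Fin n → Fin n → Fin n → Fin n → ℂ) (x y : Fin n → ℂ) :
    CQB R (Matrix.vecMulVec x y) = norm2 x * (ricForm R y y).re - (bisec R x y).re := by
  have hric : ∑ a, ∑ b, ∑ c, ricT R a b * Matrix.vecMulVec x y c a *
      star (Matrix.vecMulVec x y c b) = norm2 x * ricForm R y y := by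
    rw [ofReal_norm2, ricForm, Finset.mul_sum]
    refine Finset.sum_congr rfl fun a _ ↦ ?_
    rw [Finset.mul_sum]
    refine Finset.sum_congr rfl fun b _ ↦ ?_
    rw [Finset.sum_mul]
    refine Finset.sum_congr rfl fun c _ ↦ ?_
    rw [Matrix.vecMulVec_apply, Matrix.vecMulVec_apply, star_mul']
    ring
  have hbisec : ∑ a, ∑ b, ∑ c, ∑ d, R a b c d * Matrix.vecMulVec x y a c *
      star (Matrix.vecMulVec x y b d) = bisec R x y := by
    unfold bisec
    refine Finset.sum_congr rfl fun a _ ↦ Finset.sum_congr rfl fun b _ ↦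
      Finset.sum_congr rfl fun c _ ↦ Finset.sum_congr rfl fun d _ ↦ ?_
    rw [Matrix.vecMulVec_apply, Matrix.vecMulVec_apply, star_mul']
    ring
  rw [CQB, hric, hbisec, Complex.sub_re, Complex.re_ofReal_mul]

/-- The value at `x` of a positive semidefinite sesquilinear form is at most `‖x‖²` times its
trace. -/
theorem sesq_re_le_norm2_mul_trace {n : ℕ} (h : Fin n → Fin n → ℂ)
    (hh : ∀ u : Fin n → ℂ, 0 ≤ (∑ c, ∑ d, h c d * u c * star (u d)).re) (x : Fin n → ℂ) :
    (∑ c, ∑ d, h c d * x c * star (x d)).re ≤ norm2 x * (∑ c, h c c).re := by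
  have hpair (p q : Fin n) : 0 ≤ (h p p * (x q * star (x q)) + h q q * (x p * star (x p))
      - h p q * x p * star (x q) - h q p * x q * star (x p)).re := by
    convert hh (Pi.single p (star (x q)) - Pi.single q (star (x p))) using 2
    simp only [Pi.sub_apply, star_sub, mul_sub, sub_mul, Finset.sum_sub_distrib, Pi.single_apply,
      apply_ite star, star_star, star_zero, mul_ite, ite_mul, mul_zero, zero_mul,
      Finset.sum_ite_eq', Finset.mem_univ, if_true]
    ring
  have hsum : 0 ≤ (∑ p, ∑ q, (h p p * (x q * star (x q)) + h q q * (x p * star (x p))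
      - h p q * x p * star (x q) - h q p * x q * star (x p))).re := by
    simp only [Complex.re_sum]
    exact Finset.sum_nonneg fun p _ ↦ Finset.sum_nonneg fun q _ ↦ hpair p q
  have heq : ∑ p, ∑ q, (h p p * (x q * star (x q)) + h q q * (x p * star (x p))
      - h p q * x p * star (x q) - h q p * x q * star (x p)) =
      2 * ((norm2 x : ℂ) * (∑ c, h c c) - ∑ c, ∑ d, h c d * x c * star (x d)) := by
    simp only [Finset.sum_sub_distrib, Finset.sum_add_distrib]
    rw [Finset.sum_comm (f := fun p q ↦ h q p * x q * star (x p))]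
    simp only [← Finset.mul_sum (f := fun i ↦ x i * star (x i)),
      ← Finset.sum_mul (f := fun i ↦ h i i), ← ofReal_norm2]
    ring
  rw [heq, ← Complex.ofReal_ofNat, Complex.re_ofReal_mul, Complex.sub_re, Complex.re_ofReal_mul] at hsum
  linarith

theorem sum_pair_comm {ι M : Type*} [Fintype ι] [AddCommMonoid M] (f : ι → ι → ι → ι → M) :
    ∑ a, ∑ b, ∑ c, ∑ d, f a b c d = ∑ c, ∑ d, ∑ a, ∑ b, f a b c d := by
  simpa only [Fintype.sum_prod_type] using Finset.sum_comm (s := Finset.univ) (t := Finset.univ)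
    (f := fun p q : ι × ι ↦ f p.1 p.2 q.1 q.2)

theorem bisec_comm {n : ℕ} {R : Fin n → Fin n → Fin n → Fin n → ℂ} (hR : IsKahlerCurv R)
    (x y : Fin n → ℂ) : bisec R x y = bisec R y x := by
  have hswap (a b c d : Fin n) : R a b c d = R c d a b := by rw [hR.1, hR.2.1]
  unfold bisec
  rw [sum_pair_comm]
  refine Finset.sum_congr rfl fun a _ ↦ Finset.sum_congr rfl fun b _ ↦
    Finset.sum_congr rfl fun c _ ↦ Finset.sum_congr rfl fun d _ ↦ ?_
  rw [hswap]
  ring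

/-- The coefficients of the sesquilinear form `R(x, x̄, ·, ·)`. -/
noncomputable def bisecCoeff {n : ℕ} (R : Fin n → Fin n → Fin n → Fin n → ℂ) (x : Fin n → ℂ)
    (c d : Fin n) : ℂ :=
  ∑ a, ∑ b, R a b c d * x a * star (x b)

theorem sum_bisecCoeff {n : ℕ} (R : Fin n → Fin n → Fin n → Fin n → ℂ) (x u : Fin n → ℂ) :
    ∑ c, ∑ d, bisecCoeff R x c d * u c * star (u d) = bisec R x u := by
  unfold bisec bisecCoeff
  simp only [Finset.sum_mul]
  exact sum_pair_comm _

theorem sum_bisecCoeff_diag {n : ℕ} (R : Fin n → Fin n → Fin n → Fin n → ℂ) (x : Fin n → ℂ) :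
    ∑ c, bisecCoeff R x c c = ricForm R x x := by
  unfold ricForm ricT bisecCoeff
  rw [Finset.sum_comm]
  refine Finset.sum_congr rfl fun a _ ↦ ?_
  rw [Finset.sum_comm]
  simp only [Finset.sum_mul]

/-- If `‖u‖² Ric(x, x̄) ≤ R(x, x̄, u, ū)` for all `u`, then summing over an orthonormal basis of the
complement of `x` bounds `(n - 1) Ric(x, x̄)`. -/
theorem ricForm_le_of_forall_bisec {n : ℕ} (R : Fin n → Fin n → Fin n → Fin n → ℂ) (x : Fin n → ℂ)
    (h : ∀ u, norm2 u * (ricForm R x x).re ≤ (bisec R x u).re) :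
    ((n : ℝ) - 1) * norm2 x * (ricForm R x x).re ≤
      norm2 x * (ricForm R x x).re - (bisec R x x).re := by
  set r := (ricForm R x x).re with hr
  have hform (u : Fin n → ℂ) :
      (∑ c, ∑ d, (bisecCoeff R x c d - if c = d then (r : ℂ) else 0) * u c * star (u d)).re =
        (bisec R x u).re - norm2 u * r := by
    simp only [sub_mul, Finset.sum_sub_distrib, ite_mul, zero_mul,
      Finset.sum_ite_eq, Finset.mem_univ, if_true, mul_assoc, ← Finset.mul_sum]
    simp only [← mul_assoc, sum_bisecCoeff, ← ofReal_norm2]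
    rw [Complex.sub_re, Complex.re_ofReal_mul, Complex.ofReal_re, mul_comm]
  have key := sesq_re_le_norm2_mul_trace
    (fun c d ↦ bisecCoeff R x c d - if c = d then (r : ℂ) else 0)
    (fun u ↦ by rw [hform]; linarith [h u]) x
  have htrace : (∑ c, (bisecCoeff R x c c - if c = c then (r : ℂ) else 0)).re = r - n * r := by
    simp [Finset.sum_sub_distrib, sum_bisecCoeff_diag, hr]
  rw [hform, htrace] at key
  linarith

/-- Theorem 5.1 (CQB part): `CQB₁ ≤ 0` iff `‖x‖²·Ric(y,ȳ) − R(x,x̄,y,ȳ) ≤ 0` for all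
`x, y`; strict for nonzero vectors when `CQB₁ < 0`; and under `CQB₁ ≤ 0` one has
`(n−1)·‖x‖²·Ric(x,x̄) ≤ ‖x‖²·Ric(x,x̄) − R(x,x̄,x,x̄) ≤ 0`, in particular `Ric ≤ 0`. -/
theorem cqb_one_nonpos (n : ℕ) (hn : 2 ≤ n)
    (R : Fin n → Fin n → Fin n → Fin n → ℂ) (hR : IsKahlerCurv R) :
    ((∀ A : Matrix (Fin n) (Fin n) ℂ, A.rank ≤ 1 → CQB R A ≤ 0) ↔
      (∀ x y : Fin n → ℂ, norm2 x * (ricForm R y y).re - (bisec R x y).re ≤ 0)) ∧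
    ((∀ A : Matrix (Fin n) (Fin n) ℂ, A ≠ 0 → A.rank ≤ 1 → CQB R A < 0) →
      (∀ x y : Fin n → ℂ, x ≠ 0 → y ≠ 0 →
        norm2 x * (ricForm R y y).re - (bisec R x y).re < 0)) ∧
    ((∀ A : Matrix (Fin n) (Fin n) ℂ, A.rank ≤ 1 → CQB R A ≤ 0) →
      ∀ x : Fin n → ℂ,
        ((n : ℝ) - 1) * norm2 x * (ricForm R x x).re ≤
          norm2 x * (ricForm R x x).re - (bisec R x x).re ∧
        norm2 x * (ricForm R x x).re - (bisec R x x).re ≤ 0 ∧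
        (ricForm R x x).re ≤ 0) := by
  have hiff : (∀ A : Matrix (Fin n) (Fin n) ℂ, A.rank ≤ 1 → CQB R A ≤ 0) ↔
      ∀ x y : Fin n → ℂ, norm2 x * (ricForm R y y).re - (bisec R x y).re ≤ 0 := by
    refine ⟨fun h x y ↦ CQB_vecMulVec R x y ▸ h _ (Matrix.rank_vecMulVec_le x y), fun h A hA ↦ ?_⟩
    obtain ⟨x, y, rfl⟩ := Matrix.exists_eq_vecMulVec_of_rank_le_one hA
    exact CQB_vecMulVec R x y ▸ h x y
  refine ⟨hiff, fun h x y hx hy ↦ ?_, fun h x ↦ ?_⟩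
  · rw [← CQB_vecMulVec]
    exact h _ (Matrix.vecMulVec_ne_zero hx hy) (Matrix.rank_vecMulVec_le x y)
  · have hneg := hiff.mp h
    have hlower := ricForm_le_of_forall_bisec R x fun u ↦ by
      rw [bisec_comm hR]
      linarith [hneg u x]
    refine ⟨hlower, hneg x x, ?_⟩
    rcases eq_or_ne x 0 with rfl | hx
    · simp [ricForm]
    · have hn1 : (0 : ℝ) < n - 1 := by
        have : (2 : ℝ) ≤ n := by exact_mod_cast hn
        linarith
      exact nonpos_of_mul_nonpos_right (hlower.trans (hneg x x)) (mul_pos hn1 (norm2_pos hx))
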